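/- Let (Z, μ, T) be an ergodic system, P a finite partition, and suppose P ⊂_δ ⋁_{i∈ℤ} TⁱQ (there is a ⋁TⁱQ-measurable partition within distance δ of P). Then for every ε > 0 there exists K such that for every Rohlin tower 𝒯 = (A, M) with M > K covering more than ε of the space, there is a function Φ from Q-names of length M to finite sets of P-names of length M such that: (1) |Φ(n)| < 2^{(H(δ) + δ·log₂|P| + ε)·M} for all n; and (2) the set of z ∈ A with ν_{𝒯,P}(z) ∈ Φ(ν_{𝒯,Q}(z)) has measure greater than (1−ε)·μ(A). -/

import Mathlib

open MeasureTheory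

/-- The binary entropy function, in base 2. -/
noncomputable def binEnt (x : ℝ) : ℝ := -x * Real.logb 2 x - (1 - x) * Real.logb 2 (1 - x)

/-- The `i`-th power (for `i : ℤ`) of an invertible transformation. -/
noncomputable def zIter {Z : Type*} [MeasurableSpace Z] (T : Z ≃ᵐ Z) (i : ℤ) : Z → Z :=
  ⇑(T.toEquiv ^ i)

section helpers
open Filter Topology

def Agr {Z : Type*} {q : ℕ} (F : ℤ → Z → Fin q) (L : ℕ) (z z' : Z) : Prop :=
  ∀ i : ℤ, |i| ≤ (L : ℤ) → F i z = F i z'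

def Sat {Z : Type*} {q : ℕ} (F : ℤ → Z → Fin q) (L : ℕ) (D : Set Z) : Prop :=
  ∀ z z', Agr F L z z' → (z ∈ D ↔ z' ∈ D)

lemma Sat.mono {Z : Type*} {q : ℕ} {F : ℤ → Z → Fin q} {L L' : ℕ} {D : Set Z}
    (h : Sat F L D) (hL : L ≤ L') : Sat F L' D :=
  fun z z' hz => h z z' fun i hi => hz i (hi.trans (by exact_mod_cast hL))

lemma sat_meas {Z : Type*} {q : ℕ} (m : MeasurableSpace Z) (F : ℤ → Z → Fin q)
    (hF : ∀ i, Measurable (F i)) {L : ℕ} {D : Set Z} (hD : Sat F L D) : MeasurableSet D := by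
  let W : Z → (Finset.Icc (-(L:ℤ)) L → Fin q) := fun z i => F i z
  have hW : Measurable W := measurable_pi_lambda _ fun i => hF i
  have : D = W ⁻¹' (W '' D) := by
    ext z
    constructor
    · intro h; exact ⟨z, h, rfl⟩
    · rintro ⟨z', h', he⟩
      refine (hD z' z fun i hi => ?_).1 h'
      have := congrFun he ⟨i, by rw [Finset.mem_Icc]; exact abs_le.1 hi⟩
      exact this
  rw [this]
  exact hW (Set.toFinite _).measurableSet

lemma approx_set {Z : Type*} {q : ℕ} [m0 : MeasurableSpace Z] (μ : Measure Z)
    [IsProbabilityMeasure μ] (F : ℤ → Z → Fin q)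
    (hF : ∀ i, Measurable (F i)) (s : Set Z)
    (hs : MeasurableSet[⨆ i : ℤ, MeasurableSpace.comap (F i) ⊤] s) (ε : ENNReal) (hε : 0 < ε) :
    ∃ L D, Sat F L D ∧ μ (symmDiff D s) < ε := by
  set m : MeasurableSpace Z := ⨆ i : ℤ, MeasurableSpace.comap (F i) ⊤ with hm
  have hle : m ≤ m0 := iSup_le fun i => by
    rintro t ⟨u, -, rfl⟩
    exact hF i (Set.toFinite _).measurableSet
  have hFm : ∀ i, Measurable[m] (F i) := fun i => by
    intro u _
    exact (le_iSup (fun i : ℤ => MeasurableSpace.comap (F i) ⊤) i) _ ⟨u, trivial, rfl⟩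
  let C : Set (Set Z) := {D | ∃ L, Sat F L D}
  have hC : IsSetRing C := by
    refine ⟨⟨0, fun z z' _ => by simp⟩, ?_, ?_⟩
    · rintro s t ⟨L, h⟩ ⟨L', h'⟩
      refine ⟨max L L', fun z z' hz => ?_⟩
      have := h.mono (le_max_left L L') z z' hz
      have := h'.mono (le_max_right L L') z z' hz
      simp_all
    · rintro s t ⟨L, h⟩ ⟨L', h'⟩
      refine ⟨max L L', fun z z' hz => ?_⟩
      have := h.mono (le_max_left L L') z z' hz
      have := h'.mono (le_max_right L L') z z' hz
      simp_all
  have hgen : m = MeasurableSpace.generateFrom C := by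
    apply le_antisymm
    · refine iSup_le fun i => ?_
      rintro t ⟨u, -, rfl⟩
      refine MeasurableSpace.measurableSet_generateFrom ⟨i.natAbs, fun z z' hz => ?_⟩
      have := hz i (by simp)
      simp [this]
    · refine MeasurableSpace.generateFrom_le ?_
      rintro D ⟨L, hD⟩
      exact sat_meas m F hFm hD
  obtain ⟨D, ⟨L, hD⟩, hlt⟩ := @exists_measure_symmDiff_lt_of_generateFrom_isSetRing Z m (μ.trim hle)
    inferInstance C hC ⟨{Set.univ}, by simp, by
      rintro _ rfl; exact ⟨0, fun z z' _ => by simp⟩, by simp⟩ hgen s hs ε hε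
  refine ⟨L, D, hD, ?_⟩
  rwa [trim_measurableSet_eq hle] at hlt
  exact MeasurableSet.symmDiff (sat_meas m F hFm hD) hs

lemma approx_fun {Z : Type*} {p q : ℕ} [m0 : MeasurableSpace Z] (μ : Measure Z)
    [IsProbabilityMeasure μ] (F : ℤ → Z → Fin q)
    (hF : ∀ i, Measurable (F i)) (R : Z → Fin p) 
    (hR : Measurable[⨆ i : ℤ, MeasurableSpace.comap (F i) ⊤] R) (ε : ENNReal) (hε : 0 < ε) :
    ∃ L, ∃ R' : Z → Fin p, (∀ z z', Agr F L z z' → R' z = R' z') ∧ Measurable R' ∧ 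
      μ {z | R z ≠ R' z} ≤ ε := by
  classical
  have hp : 0 < p := by
    obtain ⟨z⟩ := μ.nonempty_of_neZero
    exact (R z).pos
  have h := fun a : Fin p => approx_set μ F hF (R ⁻¹' {a}) (hR (measurableSet_singleton a)) (ε / p)
    (ENNReal.div_pos hε.ne' (by simp))
  choose L D hD hlt using h
  let N := Finset.univ.sup L
  have hD' : ∀ a, Sat F N (D a) := fun a => (hD a).mono (Finset.le_sup (Finset.mem_univ a))
  let R' : Z → Fin p := fun z => if h : ∃ a, z ∈ D a then h.choose else ⟨0, hp⟩
  have hR' : ∀ z z', Agr F N z z' → R' z = R' z' := by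
    intro z z' hz
    have : ∀ a, (z ∈ D a) = (z' ∈ D a) := fun a => propext (hD' a z z' hz)
    simp only [R', this]
  refine ⟨N, R', hR', ?_, ?_⟩
  · intro u _
    refine sat_meas m0 F hF (L := N) fun z z' hz => ?_
    simp [hR' z z' hz]
  · have : {z | R z ≠ R' z} ⊆ ⋃ a, symmDiff (D a) (R ⁻¹' {a}) := by
      intro z hz
      by_contra hn
      simp only [Set.mem_iUnion, not_exists, Set.mem_symmDiff, Set.mem_preimage, Set.mem_singleton_iff] at hn
      have hall : ∀ a, z ∈ D a ↔ R z = a := fun a => by have := hn a; tauto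
      apply hz
      have hex : ∃ a, z ∈ D a := ⟨R z, (hall _).2 rfl⟩
      have h1 := hex.choose_spec
      have : R' z = hex.choose := by simp [R', hex]
      rw [this]
      exact (hall _).1 h1
    calc μ {z | R z ≠ R' z} ≤ μ (⋃ a, symmDiff (D a) (R ⁻¹' {a})) := measure_mono this
      _ ≤ ∑ a, μ (symmDiff (D a) (R ⁻¹' {a})) := measure_iUnion_fintype_le _ _
      _ ≤ ∑ a : Fin p, ε / p := Finset.sum_le_sum fun a _ => (hlt a).le
      _ = ε := by
        simp only [Finset.sum_const, Finset.card_univ, Fintype.card_fin, nsmul_eq_mul]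
        exact ENNReal.mul_div_cancel (by simp [hp.ne']) (by simp)
lemma iter_ae {Z : Type*} [MeasurableSpace Z] (μ : Measure Z) 
    (T : Z → Z) (hT : MeasurePreserving T μ μ) (x : Lp ℝ 2 μ) (n : ℕ) :
    ((Lp.compMeasurePreserving T hT)^[n] x : Lp ℝ 2 μ) =ᵐ[μ] (x : Z → ℝ) ∘ T^[n] := by
  induction n with
  | zero => simp
  | succ n ih =>
    rw [Function.iterate_succ_apply', Function.iterate_succ]
    refine (Lp.coeFn_compMeasurePreserving _ hT).trans ?_
    exact hT.quasiMeasurePreserving.ae_eq_comp ih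

lemma mean_erg {Z : Type*} [MeasurableSpace Z] (μ : Measure Z) [IsProbabilityMeasure μ]
    (T : Z → Z) (hT : Ergodic T μ) (E : Set Z) (hE : MeasurableSet E) (c : ℝ)
    (hc : μ.real E < c) (η : ENNReal) (hη : 0 < η) :
    ∃ K : ℕ, ∀ M : ℕ, K < M →
      μ {z | c * M < ∑ j ∈ Finset.range M, E.indicator (fun _ => (1:ℝ)) (T^[j] z)} < η := by
  have hTm := hT.toMeasurePreserving
  let U : Lp ℝ 2 μ →L[ℝ] Lp ℝ 2 μ :=
    (Lp.compMeasurePreservingₗᵢ ℝ T hTm).toContinuousLinearMap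
  have hU : ‖U‖ ≤ 1 := LinearIsometry.norm_toContinuousLinearMap_le _
  let e : Lp ℝ 2 μ := indicatorConstLp 2 hE (measure_ne_top μ _) (1:ℝ)
  let one : Lp ℝ 2 μ := indicatorConstLp 2 MeasurableSet.univ (measure_ne_top μ _) (1:ℝ)
  let x : Lp ℝ 2 μ := e - μ.real E • one
  have hone : inner ℝ x one = 0 := by
    simp only [x, inner_sub_left, real_inner_smul_left, e, one,
      L2.real_inner_indicatorConstLp_one_indicatorConstLp_one]
    simp
  have hlim := U.tendsto_birkhoffAverage_orthogonalProjection hU x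
  set S := U.eqLocus (1 : Lp ℝ 2 μ →L[ℝ] Lp ℝ 2 μ) with hS
  have hzero : ((S.orthogonalProjectionOnto x : S) : Lp ℝ 2 μ) = 0 := by
    set y := S.orthogonalProjectionOnto x with hy
    have hyf : U (y : Lp ℝ 2 μ) = y := y.2
    have hya : ((y : Lp ℝ 2 μ) : Z → ℝ) ∘ T =ᵐ[μ] ((y : Lp ℝ 2 μ) : Z → ℝ) := by
      have h1 := Lp.coeFn_compMeasurePreserving (y : Lp ℝ 2 μ) hTm
      have h2 : Lp.compMeasurePreserving T hTm (y : Lp ℝ 2 μ) = y := hyf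
      rw [h2] at h1
      exact h1.symm
    obtain ⟨a, ha⟩ := hT.ae_eq_const_of_ae_eq_comp_ae (Lp.aestronglyMeasurable _) hya
    have hyo : (y : Lp ℝ 2 μ) = a • one := by
      apply Lp.ext
      filter_upwards [ha, Lp.coeFn_smul a one, indicatorConstLp_coeFn (p := 2) (hs := MeasurableSet.univ) (hμs := measure_ne_top μ _) (c := (1:ℝ))] with z h1 h2 h3
      rw [h1, h2]
      simp [one]
    have h0 : inner ℝ (x - (y : Lp ℝ 2 μ)) (y : Lp ℝ 2 μ) = 0 :=
      Submodule.starProjection_inner_eq_zero x _ y.2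
    rw [inner_sub_left, sub_eq_zero] at h0
    rw [← inner_self_eq_zero (𝕜 := ℝ), ← h0]
    nth_rewrite 1 [hyo]
    rw [real_inner_smul_right, hone, mul_zero]
  rw [hzero] at hlim
  have hmeas := tendstoInMeasure_of_tendsto_Lp hlim
  have h1 := hmeas (ENNReal.ofReal (c - μ.real E)) (by simpa using hc)
  have h2 := (h1.eventually (gt_mem_nhds hη)).and (eventually_gt_atTop 0)
  obtain ⟨K, hK⟩ := eventually_atTop.1 h2
  refine ⟨K, fun M hM => lt_of_le_of_lt ?_ (hK M hM.le).1⟩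
  have hMpos : (0:ℝ) < M := by exact_mod_cast (hK M hM.le).2
  apply measure_mono_ae
  have hx : (x : Z → ℝ) =ᵐ[μ] fun z => E.indicator (fun _ => (1:ℝ)) z - μ.real E := by
    filter_upwards [Lp.coeFn_sub e (μ.real E • one), Lp.coeFn_smul (μ.real E) one, indicatorConstLp_coeFn (p := 2) (hs := MeasurableSet.univ) (hμs := measure_ne_top μ _) (c := (1:ℝ)), indicatorConstLp_coeFn (p := 2) (hs := hE) (hμs := measure_ne_top μ _) (c := (1:ℝ))] with z h1 h2 h3 h4
    simp only [x]
    rw [h1, Pi.sub_apply, h2]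
    simp [one, e, h4]
  have hit : ∀ j, (U^[j] x : Lp ℝ 2 μ) =ᵐ[μ] fun z => E.indicator (fun _ => (1:ℝ)) (T^[j] z) - μ.real E := by
    intro j
    refine (iter_ae μ T hTm x j).trans ?_
    exact (hTm.iterate j).quasiMeasurePreserving.ae_eq_comp hx
  have hav : (birkhoffAverage ℝ U _root_.id M x : Lp ℝ 2 μ) =ᵐ[μ]
      fun z => (M:ℝ)⁻¹ * ∑ j ∈ Finset.range M, (E.indicator (fun _ => (1:ℝ)) (T^[j] z) - μ.real E) := by
    unfold birkhoffAverage birkhoffSum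
    filter_upwards [Lp.coeFn_smul (M:ℝ)⁻¹ (∑ j ∈ Finset.range M, _root_.id (U^[j] x)),
      Lp.coeFn_fun_finsetSum (Finset.range M) (fun j => _root_.id (U^[j] x)), ae_all_iff.2 hit] with z h1 h2 h3
    rw [h1, Pi.smul_apply, h2]
    simp [h3]
  filter_upwards [hav, Lp.coeFn_zero ℝ 2 μ] with z h1 h2 h3
  change c * M < ∑ j ∈ Finset.range M, E.indicator (fun _ => (1:ℝ)) (T^[j] z) at h3
  change ENNReal.ofReal (c - μ.real E) ≤ _
  rw [h1, h2, Pi.zero_apply, edist_zero_right, Real.enorm_eq_ofReal_abs]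
  apply ENNReal.ofReal_le_ofReal
  refine le_trans ?_ (le_abs_self _)
  rw [Finset.sum_sub_distrib, le_inv_mul_iff₀ hMpos]
  simp only [Finset.sum_const, Finset.card_range, nsmul_eq_mul]
  nlinarith

lemma ball_card {M p k : ℕ} (hk : k ≤ M) (c : Fin M → Fin p) :
    (Finset.univ.filter fun w : Fin M → Fin p =>
      (Finset.univ.filter fun j => w j ≠ c j).card ≤ k).card ≤ M.choose k * p ^ k := by
  classical
  have hsub : (Finset.univ.filter fun w : Fin M → Fin p =>
      (Finset.univ.filter fun j => w j ≠ c j).card ≤ k) ⊆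
      (Finset.powersetCard k (Finset.univ : Finset (Fin M))).biUnion fun S =>
        Fintype.piFinset fun j => if j ∈ S then Finset.univ else {c j} := by
    intro w hw
    simp only [Finset.mem_filter, Finset.mem_univ, true_and] at hw
    obtain ⟨S, hS, hc⟩ := Finset.exists_superset_card_eq hw (by simpa using hk)
    simp only [Finset.mem_biUnion, Finset.mem_powersetCard, Fintype.mem_piFinset]
    refine ⟨S, ⟨Finset.subset_univ _, hc⟩, fun j => ?_⟩
    split_ifs with hj
    · simp
    · simp only [Finset.mem_singleton]
      by_contra hne
      exact hj (hS (by simpa using hne))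
  refine (Finset.card_le_card hsub).trans ?_
  refine (Finset.card_biUnion_le_card_mul _ _ (p ^ k) ?_).trans ?_
  · intro S hS
    rw [Finset.mem_powersetCard] at hS
    rw [Fintype.card_piFinset]
    have : ∀ j, (if j ∈ S then (Finset.univ : Finset (Fin p)) else {c j}).card = if j ∈ S then p else 1 := by
      intro j; split_ifs <;> simp
    simp only [this]
    rw [Finset.prod_ite_mem]
    simp [hS.2]
  · simp

lemma choose_bound {δ : ℝ} (h0 : 0 < δ) (h1 : δ < 1) {M k : ℕ} (hkM : k ≤ M) :
    (M.choose k : ℝ) * (δ ^ k * (1 - δ) ^ (M - k)) ≤ 1 := by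
  have h := add_pow δ (1 - δ) M
  simp only [add_sub_cancel, one_pow] at h
  rw [mul_comm]
  refine le_of_le_of_eq ?_ h.symm
  exact Finset.single_le_sum (f := fun m => δ ^ m * (1 - δ) ^ (M - m) * (M.choose m : ℝ))
    (fun m _ => by have : 0 < 1 - δ := by linarith
                   positivity) (Finset.mem_range.2 (Nat.lt_succ_of_le hkM))

lemma count_bound {δ ε : ℝ} (h0 : 0 < δ) (h1 : δ < 1) {p M k : ℕ} (hp : 0 < p) (hkM : k ≤ M)
    (hk : (k : ℝ) ≤ δ * M) (hk' : δ * M < k + 1) (hM : -Real.logb 2 (1 - δ) < ε * M) :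
    ((M.choose k * p ^ k : ℕ) : ℝ) < (2 : ℝ) ^ ((binEnt δ + δ * Real.logb 2 p + ε) * M) := by
  have h1' : 0 < 1 - δ := by linarith
  have hC : (0:ℝ) < M.choose k := by exact_mod_cast Nat.choose_pos hkM
  have hpR : (0:ℝ) < p := by exact_mod_cast hp
  have hlp : 0 ≤ Real.logb 2 p := Real.logb_nonneg (by norm_num) (by exact_mod_cast hp)
  have hb := choose_bound h0 h1 hkM
  have hlog : Real.logb 2 ((M.choose k : ℝ) * (δ ^ k * (1 - δ) ^ (M - k))) ≤ 0 :=
    Real.logb_nonpos (by norm_num) (by positivity) hb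
  rw [Real.logb_mul (by positivity) (by positivity), Real.logb_mul (by positivity) (by positivity),
    Real.logb_pow, Real.logb_pow, Nat.cast_sub hkM] at hlog
  have ha : Real.logb 2 δ < 0 := Real.logb_neg (by norm_num) h0 h1
  have hb' : Real.logb 2 (1 - δ) < 0 := Real.logb_neg (by norm_num) h1' (by linarith)
  push_cast
  rw [← Real.logb_lt_iff_lt_rpow (by norm_num) (by positivity),
    Real.logb_mul (by positivity) (by positivity), Real.logb_pow]
  unfold binEnt
  have e1 := mul_nonneg (sub_nonneg.2 hk) (neg_nonneg.2 ha.le)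
  have e2 := mul_nonneg (sub_nonneg.2 hk) hlp
  have e3 := mul_nonneg (sub_nonneg.2 hk'.le) (neg_nonneg.2 hb'.le)
  nlinarith

section tower
variable {Z : Type*} [MeasurableSpace Z] (μ : Measure Z) 

lemma image_iter (T : Z ≃ᵐ Z) (hT : MeasurePreserving T μ μ) (B : Set Z) (hB : MeasurableSet B)
    (j : ℕ) : MeasurableSet ((⇑T)^[j] '' B) ∧ μ ((⇑T)^[j] '' B) = μ B := by
  induction j with
  | zero => simpa using hB
  | succ n ih =>
    have h : (⇑T)^[n+1] '' B = T '' ((⇑T)^[n] '' B) := by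
      rw [Function.iterate_succ', Set.image_comp]
    have hm : MeasurableSet (T '' ((⇑T)^[n] '' B)) := T.measurableSet_image.2 ih.1
    rw [h]
    refine ⟨hm, ?_⟩
    rw [← ih.2, ← hT.measure_preimage hm.nullMeasurableSet,
      Set.preimage_image_eq _ T.injective]

lemma tower_lower (T : Z ≃ᵐ Z) (hT : MeasurePreserving T μ μ) (A B Bad : Set Z)
    (hB : MeasurableSet B) (hBA : B ⊆ A) (M m : ℕ) (hm : m ≤ M)
    (hd : ∀ i j, i < M → j < M → i ≠ j → Disjoint ((⇑T)^[i] '' A) ((⇑T)^[j] '' A))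
    (hbad : ∀ j < m, ∀ z ∈ B, (⇑T)^[j] z ∈ Bad) : (m : ENNReal) * μ B ≤ μ Bad := by
  have : μ (⋃ j ∈ Finset.range m, (⇑T)^[j] '' B) = m * μ B := by
    rw [measure_biUnion_finset]
    · simp [fun j => (image_iter μ T hT B hB j).2]
    · intro i hi j hj hij
      simp only [Finset.coe_range, Set.mem_Iio] at hi hj
      exact (hd i j (by omega) (by omega) hij).mono (Set.image_mono hBA) (Set.image_mono hBA)
    · intro j _; exact (image_iter μ T hT B hB j).1
  rw [← this]
  apply measure_mono
  intro y hy
  simp only [Set.mem_iUnion, Finset.mem_range] at hy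
  obtain ⟨j, hj, z, hz, rfl⟩ := hy
  exact hbad j hj z hz

lemma tower_upper (T : Z ≃ᵐ Z) (hT : MeasurePreserving T μ μ) (A : Set Z)
    (hA : MeasurableSet A) (M : ℕ) : μ (⋃ i ∈ Finset.range M, (⇑T)^[i] '' A) ≤ M * μ A := by
  refine (measure_biUnion_finset_le _ _).trans ?_
  simp [fun j => (image_iter μ T hT A hA j).2]

lemma zIter_meas (T : Z ≃ᵐ Z) (i : ℤ) : Measurable (zIter T i) := by
  have key : ∀ n : ℕ, Measurable (⇑(T.toEquiv ^ n)) ∧ Measurable (⇑((T.toEquiv ^ n)⁻¹)) := by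
    intro n
    constructor
    · have : ⇑(T.toEquiv ^ n) = (⇑T)^[n] := (Equiv.Perm.iterate_eq_pow T.toEquiv n).symm
      rw [this]; exact T.measurable.iterate n
    · have : ⇑((T.toEquiv ^ n)⁻¹) = (⇑T.symm)^[n] := by
        rw [← inv_pow]; exact (Equiv.Perm.iterate_eq_pow (T.toEquiv⁻¹) n).symm
      rw [this]; exact T.symm.measurable.iterate n
  unfold zIter
  cases i with
  | ofNat n => simpa using (key n).1
  | negSucc n => rw [zpow_negSucc]; exact (key _).2

lemma zIter_iter (T : Z ≃ᵐ Z) (i : ℤ) (j k : ℕ) (h : (k : ℤ) = j + i) (z : Z) :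
    zIter T i ((⇑T)^[j] z) = (⇑T)^[k] z := by
  have e : ∀ n : ℕ, (⇑T)^[n] = ⇑(T.toEquiv ^ n) := fun n => Equiv.Perm.iterate_eq_pow T.toEquiv n
  unfold zIter
  rw [e, e, ← Equiv.Perm.mul_apply, ← zpow_natCast, ← zpow_natCast, ← zpow_add, h, add_comm]

end tower

lemma shift_sum {Z : Type*} (T : Z → Z) (E : Set Z) (M j : ℕ) (z : Z) :
    (∑ i ∈ Finset.range M, E.indicator (fun _ => (1:ℝ)) (T^[i] z)) - j ≤
    ∑ i ∈ Finset.range M, E.indicator (fun _ => (1:ℝ)) (T^[i] (T^[j] z)) := by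
  set f : ℕ → ℝ := fun i => E.indicator (fun _ => (1:ℝ)) (T^[i] z) with hf
  have hf0 : ∀ i, 0 ≤ f i := fun i => Set.indicator_nonneg (fun _ _ => zero_le_one) _
  have hf1 : ∀ i, f i ≤ 1 := fun i => Set.indicator_le_self' (fun _ _ => zero_le_one) _
  have h1 : ∑ i ∈ Finset.range M, E.indicator (fun _ => (1:ℝ)) (T^[i] (T^[j] z))
      = ∑ i ∈ Finset.range M, f (j + i) := by
    refine Finset.sum_congr rfl fun i _ => ?_
    rw [hf, ← Function.iterate_add_apply, add_comm]
  have h2 := Finset.sum_range_add f j M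
  have h3 : ∑ i ∈ Finset.range M, f i ≤ ∑ i ∈ Finset.range (j + M), f i :=
    Finset.sum_le_sum_of_subset_of_nonneg (Finset.range_mono (by omega)) fun i _ _ => hf0 i
  have h4 : ∑ i ∈ Finset.range j, f i ≤ j := by
    calc _ ≤ ∑ i ∈ Finset.range j, (1:ℝ) := Finset.sum_le_sum fun i _ => hf1 i
      _ = j := by simp
  rw [h1]; linarith

open Classical in
lemma ham_bound {Z : Type*} (T : Z → Z) {p : ℕ} (P R : Z → Fin p) (M L : ℕ) (z : Z)
    (c : Fin M → Fin p) (hc : ∀ j : Fin M, L ≤ j → (j:ℕ) + L < M → c j = R (T^[j] z)) :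
    ((Finset.univ.filter fun j : Fin M => P (T^[j] z) ≠ c j).card : ℝ) ≤
    (∑ i ∈ Finset.range M, {z | P z ≠ R z}.indicator (fun _ => (1:ℝ)) (T^[i] z)) + 2 * L := by
  have h1 : (∑ i ∈ Finset.range M, {z | P z ≠ R z}.indicator (fun _ => (1:ℝ)) (T^[i] z))
      = ((Finset.range M).filter fun i => P (T^[i] z) ≠ R (T^[i] z)).card := by
    rw [Finset.card_filter]; push_cast
    refine Finset.sum_congr rfl fun i _ => ?_
    simp [Set.indicator_apply]
  have h2 : (Finset.univ.filter fun j : Fin M => P (T^[j] z) ≠ c j).map Fin.valEmbedding ⊆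
      ((Finset.range M).filter fun i => P (T^[i] z) ≠ R (T^[i] z)) ∪
      (Finset.range L ∪ Finset.Ico (M - L) M) := by
    intro i hi
    simp only [Finset.mem_map, Finset.mem_filter, Finset.mem_univ, true_and] at hi
    obtain ⟨j, hj, rfl⟩ := hi
    simp only [Finset.mem_union, Finset.mem_filter, Finset.mem_range, Finset.mem_Ico, Fin.valEmbedding_apply]
    by_cases ha : L ≤ j
    · by_cases hb : (j:ℕ) + L < M
      · left; rw [hc j ha hb] at hj; exact ⟨j.2, hj⟩
      · right; right; have := j.2; omega
    · right; left; omega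
  have h3 := Finset.card_le_card h2
  rw [Finset.card_map] at h3
  have h4 := Finset.card_union_le ((Finset.range M).filter fun i => P (T^[i] z) ≠ R (T^[i] z))
      (Finset.range L ∪ Finset.Ico (M - L) M)
  have h5 := Finset.card_union_le (Finset.range L) (Finset.Ico (M - L) M)
  simp only [Finset.card_range, Nat.card_Ico] at h5
  rw [h1]
  exact_mod_cast (by omega : (Finset.univ.filter fun j : Fin M => P (T^[j] z) ≠ c j).card ≤
    ((Finset.range M).filter fun i => P (T^[i] z) ≠ R (T^[i] z)).card + 2 * L)

end helpers

theorem stmt17 {Z : Type*} [MeasurableSpace Z] (μ : Measure Z) [IsProbabilityMeasure μ]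
    (T : Z ≃ᵐ Z) (hT : Ergodic ⇑T μ)
    {p q : ℕ} (P : Z → Fin p) (Q : Z → Fin q) (hPm : Measurable P) (hQm : Measurable Q)
    (δ : ℝ) (hδ0 : 0 < δ) (hδ1 : δ ≤ 1)
    (hclose : ∃ R : Z → Fin p,
      Measurable[⨆ i : ℤ, MeasurableSpace.comap (fun z => Q (zIter T i z)) ⊤] R ∧
      (μ {z | P z ≠ R z}).toReal < δ)
    (ε : ℝ) (hε : 0 < ε) :
    ∃ K : ℕ, ∀ (A : Set Z) (M : ℕ), K < M → MeasurableSet A →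
      (∀ i j, i < M → j < M → i ≠ j → Disjoint ((⇑T)^[i] '' A) ((⇑T)^[j] '' A)) →
      (μ (⋃ i ∈ Finset.range M, (⇑T)^[i] '' A)).toReal > ε →
      ∃ Φ : (Fin M → Fin q) → Finset (Fin M → Fin p),
        (∀ n, ((Φ n).card : ℝ)
            < (2 : ℝ) ^ ((binEnt δ + δ * Real.logb 2 p + ε) * M)) ∧
        (μ {z | z ∈ A ∧
            (fun j : Fin M => P ((⇑T)^[(j : ℕ)] z))
              ∈ Φ (fun j : Fin M => Q ((⇑T)^[(j : ℕ)] z))}).toReal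
          > (1 - ε) * (μ A).toReal := by
  classical
  have hTm := hT.toMeasurePreserving
  have hp : 0 < p := by
    obtain ⟨z⟩ := μ.nonempty_of_neZero
    exact (P z).pos
  have hpR : (0:ℝ) < p := by exact_mod_cast hp
  rcases hδ1.eq_or_lt with rfl | hδ1
  · refine ⟨0, fun A M hM hA hd hcov => ⟨fun _ => Finset.univ, fun n => ?_, ?_⟩⟩
    · have hM' : (0:ℝ) < M := by exact_mod_cast hM
      rw [Finset.card_univ, Fintype.card_fun, Fintype.card_fin, Fintype.card_fin]
      push_cast
      rw [← Real.logb_lt_iff_lt_rpow (by norm_num) (by positivity), Real.logb_pow]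
      simp only [binEnt, Real.logb_one, sub_self]
      nlinarith [mul_pos hε hM']
    · have hup := tower_upper μ T hTm A hA M
      have hpos : 0 < (μ A).toReal := by
        by_contra hn
        have h0 : (μ A).toReal = 0 := le_antisymm (not_lt.1 hn) ENNReal.toReal_nonneg
        have h0' : μ A = 0 := by
          rcases (ENNReal.toReal_eq_zero_iff _).1 h0 with h | h
          · exact h
          · exact absurd h (measure_ne_top _ _)
        rw [h0', mul_zero] at hup
        rw [le_antisymm hup (zero_le)] at hcov
        simp at hcov; linarith
      simp only [Finset.mem_univ, and_true]
      change (1 - ε) * (μ A).toReal < (μ A).toReal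
      nlinarith
  obtain ⟨R, hR, hPR⟩ := hclose
  have hFm : ∀ i, Measurable (fun z => Q (zIter T i z)) := fun i => hQm.comp (zIter_meas T i)
  set F : ℤ → Z → Fin q := fun i z => Q (zIter T i z) with hF
  set d := (μ {z | P z ≠ R z}).toReal with hdef
  obtain ⟨L, R', hR', hR'm, hRR'⟩ := approx_fun μ F hFm R hR (ENNReal.ofReal ((δ - d) / 2))
    (by simp; linarith)
  set E : Set Z := {z | P z ≠ R' z} with hEdef
  have hE : MeasurableSet E := by
    have : E = {z | P z = R' z}ᶜ := rfl
    rw [this]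
    exact (measurableSet_eq_fun hPm hR'm).compl
  have hμE : μ.real E < δ := by
    have h1 : μ.real E ≤ μ.real {z | P z ≠ R z} + μ.real {z | R z ≠ R' z} := by
      refine (measureReal_mono ?_).trans (measureReal_union_le _ _)
      intro z hz
      by_cases h : P z = R z
      · right; intro h'; exact hz (h.trans h')
      · left; exact h
    have h2 : μ.real {z | R z ≠ R' z} ≤ (δ - d) / 2 :=
      ENNReal.toReal_le_of_le_ofReal (by linarith) hRR'
    have h3 : μ.real {z | P z ≠ R z} = d := rfl
    linarith
  have hμE0 : 0 ≤ μ.real E := measureReal_nonneg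
  set γ := (δ - μ.real E) / 4 with hγ
  have hγ0 : 0 < γ := by linarith
  have hγ1 : γ < 1 := by linarith
  obtain ⟨K₁, hK₁⟩ := mean_erg μ T hT E hE (δ - 2 * γ) (by linarith)
    (ENNReal.ofReal (γ * ε * ε)) (by simp; positivity)
  obtain ⟨K₂, hK₂⟩ := exists_nat_gt (-Real.logb 2 (1 - δ) / ε)
  obtain ⟨K₃, hK₃⟩ := exists_nat_gt (2 * L / γ)
  refine ⟨K₁ + K₂ + K₃, fun A M hM hA hd hcov => ?_⟩
  have hM0 : (0:ℝ) < M := by exact_mod_cast (by omega : 0 < M)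
  have hM1 := hK₁ M (by omega)
  have hM2 : -Real.logb 2 (1 - δ) < ε * M := by
    have : (K₂:ℝ) ≤ M := by exact_mod_cast (by omega : K₂ ≤ M)
    rw [div_lt_iff₀ hε] at hK₂; nlinarith
  have hM3 : 2 * (L:ℝ) < γ * M := by
    have : (K₃:ℝ) ≤ M := by exact_mod_cast (by omega : K₃ ≤ M)
    rw [div_lt_iff₀ hγ0] at hK₃; nlinarith
  set k := ⌊δ * M⌋₊ with hk
  have hk1 : (k:ℝ) ≤ δ * M := Nat.floor_le (by positivity)
  have hk2 : δ * M < k + 1 := Nat.lt_floor_add_one _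
  have hkM : k ≤ M := by
    have : (k:ℝ) ≤ M := by nlinarith
    exact_mod_cast this
  let ok : (Fin M → Fin q) → Fin M → Z → Prop := fun n j z' =>
    ∀ i : ℤ, |i| ≤ (L:ℤ) → ∀ h : Fin M, ((h:ℕ):ℤ) = (j:ℕ) + i → F i z' = n h
  let c : (Fin M → Fin q) → Fin M → Fin p := fun n j =>
    if h : ∃ z', ok n j z' then R' h.choose else ⟨0, hp⟩
  have hcode : ∀ z, ∀ j : Fin M, L ≤ j → (j:ℕ) + L < M →
      c (fun j : Fin M => Q ((⇑T)^[(j : ℕ)] z)) j = R' ((⇑T)^[j] z) := by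
    intro z j hj1 hj2
    have hz : ok (fun j : Fin M => Q ((⇑T)^[(j : ℕ)] z)) j ((⇑T)^[j] z) := by
      intro i hi h hh
      simp only [hF]
      rw [zIter_iter T i j h hh]
    have hex : ∃ z', ok (fun j : Fin M => Q ((⇑T)^[(j : ℕ)] z)) j z' := ⟨_, hz⟩
    have : c (fun j : Fin M => Q ((⇑T)^[(j : ℕ)] z)) j = R' hex.choose := by
      simp only [c]; rw [dif_pos hex]
    rw [this]
    apply hR'
    intro i hi
    have hi' := abs_le.1 hi
    have hlt : ((j:ℕ) + i).toNat < M := by omega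
    have hcast : (((⟨((j:ℕ) + i).toNat, hlt⟩ : Fin M) : ℕ) : ℤ) = (j:ℕ) + i := by
      simp only; omega
    rw [hex.choose_spec i hi ⟨_, hlt⟩ hcast, hz i hi ⟨_, hlt⟩ hcast]
  refine ⟨fun n => Finset.univ.filter fun w : Fin M → Fin p =>
      (Finset.univ.filter fun j => w j ≠ c n j).card ≤ k, fun n => ?_, ?_⟩
  · refine lt_of_le_of_lt ?_ (count_bound hδ0 hδ1 hp hkM hk1 hk2 hM2)
    exact_mod_cast ball_card hkM (c n)
  set e : Z → ℝ := fun z => ∑ i ∈ Finset.range M, E.indicator (fun _ => (1:ℝ)) ((⇑T)^[i] z) with he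
  have hem : Measurable e := by
    refine Finset.measurable_fun_sum _ fun i _ => ?_
    exact (measurable_const.indicator hE).comp (T.measurable.iterate i)
  set B : Set Z := A ∩ {z | (δ - γ) * M < e z} with hB
  have hBm : MeasurableSet B := hA.inter (measurableSet_lt measurable_const hem)
  set G : Set Z := {z | z ∈ A ∧ (fun j : Fin M => P ((⇑T)^[(j : ℕ)] z)) ∈
      Finset.univ.filter fun w : Fin M → Fin p =>
      (Finset.univ.filter fun j => w j ≠ c (fun j : Fin M => Q ((⇑T)^[(j : ℕ)] z)) j).card ≤ k} with hG
  have hAGB : A ⊆ G ∪ B := by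
    intro z hz
    by_cases h : (Finset.univ.filter fun j : Fin M => P ((⇑T)^[(j : ℕ)] z) ≠
        c (fun j : Fin M => Q ((⇑T)^[(j : ℕ)] z)) j).card ≤ k
    · left; exact ⟨hz, by simpa using h⟩
    · right
      refine ⟨hz, ?_⟩
      have hb := ham_bound (⇑T) P R' M L z _ (hcode z)
      have h' : (k:ℝ) + 1 ≤ (Finset.univ.filter fun j : Fin M => P ((⇑T)^[(j : ℕ)] z) ≠
        c (fun j : Fin M => Q ((⇑T)^[(j : ℕ)] z)) j).card := by
        exact_mod_cast not_le.1 h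
      change (δ - γ) * M < ∑ i ∈ Finset.range M, E.indicator (fun _ => (1:ℝ)) ((⇑T)^[i] z)
      have h6 := h'.trans hb
      linarith
  set m := ⌊γ * M⌋₊ + 1 with hm
  have hm1 : γ * M < m := by
    have := Nat.lt_floor_add_one (γ * M); simpa [hm] using this
  have hmM : m ≤ M := by
    have : ⌊γ * M⌋₊ < M := (Nat.floor_lt (by positivity)).2 (by nlinarith)
    omega
  have hlow := tower_lower μ T hTm A B
    {z | (δ - 2 * γ) * M < ∑ j ∈ Finset.range M, E.indicator (fun _ => (1:ℝ)) ((⇑T)^[j] z)}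
    hBm Set.inter_subset_left M m hmM hd (by
      intro j hj z hz
      have h1 := shift_sum (⇑T) E M j z
      have h2 : (δ - γ) * M < ∑ i ∈ Finset.range M, E.indicator (fun _ => (1:ℝ)) ((⇑T)^[i] z) := hz.2
      have h3 : (j:ℝ) ≤ γ * M := by
        have : j ≤ ⌊γ * M⌋₊ := by omega
        exact (Nat.le_floor_iff (by positivity)).1 this
      change (δ - 2 * γ) * M < _
      linarith)
  have hlow' : (m:ℝ) * μ.real B < γ * ε * ε := by
    have := hlow.trans_lt hM1
    have h2 := ENNReal.toReal_lt_of_lt_ofReal this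
    rw [ENNReal.toReal_mul, ENNReal.toReal_natCast] at h2
    exact h2
  have hup' : ε < M * μ.real A := by
    have h1 := ENNReal.toReal_mono (ENNReal.mul_ne_top (by simp) (measure_ne_top _ _))
      (tower_upper μ T hTm A hA M)
    rw [ENNReal.toReal_mul] at h1
    simp only [ENNReal.toReal_natCast] at h1
    exact lt_of_lt_of_le hcov h1
  have hsum : μ.real A ≤ μ.real G + μ.real B :=
    (measureReal_mono hAGB).trans (measureReal_union_le _ _)
  have hBlt : μ.real B < ε * μ.real A := by
    have hB0 : 0 ≤ μ.real B := measureReal_nonneg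
    have h1 : γ * M * μ.real B ≤ m * μ.real B := mul_le_mul_of_nonneg_right hm1.le hB0
    have h2 : γ * ε * ε < γ * ε * (M * μ.real A) := mul_lt_mul_of_pos_left hup' (by positivity)
    have h3 : (γ * M) * μ.real B < (γ * M) * (ε * μ.real A) := by linarith
    exact lt_of_mul_lt_mul_left h3 (by positivity)
  change (1 - ε) * μ.real A < μ.real G
  linarith
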